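/- (Work-Skipping Lemma) Let w ∈ Σ^n with n > 200, let Δ = ⌊n/50⌋, let F be an f-factorization of w, and let g = |F_{[2Δ+1 .. n−Δ]}| be the number of middle factors of F. Then there is no quasiseed v of w such that g·|v| > 2n and |v| ≤ n/50. -/

import Mathlib

/-- `v` occurs at (1-indexed) position `p` in `w`. -/
def OccursAt {α : Type*} (w v : List α) (p : ℕ) : Prop :=
  1 ≤ p ∧ p + v.length ≤ w.length + 1 ∧ (w.drop (p - 1)).take v.length = v

/-- `v` is a cover of `w`: every position of `w` lies within some occurrence of `v`. -/
def IsCover {α : Type*} (v w : List α) : Prop :=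
  ∀ q, 1 ≤ q → q ≤ w.length → ∃ p, OccursAt w v p ∧ p ≤ q ∧ q ≤ p + v.length - 1

/-- `v` is a quasiseed of `w`: `v` is a factor of `w` and `w = xyz` with
`|x| < |v|`, `|z| < |v|` and `v` a cover of `y`. -/
def IsQuasiseed {α : Type*} (v w : List α) : Prop :=
  (∃ x z, w = x ++ v ++ z) ∧
  ∃ x y z, w = x ++ y ++ z ∧ x.length < v.length ∧ z.length < v.length ∧ IsCover v y

/-- `F` is a factorization of `w`: a sequence of nonempty words concatenating to `w`,
each factor being a single letter or a factor of the concatenation of the previous ones. -/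
def IsFactorization {α : Type*} (w : List α) (F : List (List α)) : Prop :=
  F.flatten = w ∧ ∀ (t : ℕ) (ht : t < F.length), F.get ⟨t, ht⟩ ≠ [] ∧
    ((F.get ⟨t, ht⟩).length = 1 ∨ ∃ x z, x ++ F.get ⟨t, ht⟩ ++ z = (F.take t).flatten)

/-- An f-factorization: a factorization with the minimal number of factors. -/
def IsFFactorization {α : Type*} (w : List α) (F : List (List α)) : Prop :=
  IsFactorization w F ∧ ∀ G, IsFactorization w G → F.length ≤ G.length

/-- The number of factors of `F` whose block of positions is contained in `[lo..hi]`.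
The block of the `t`-th factor is `[|f₁⋯f_{t-1}|+1 .. |f₁⋯f_t|]`. -/
def NumFactorsIn {α : Type*} (F : List (List α)) (lo hi : ℕ) : ℕ :=
  ((Finset.range F.length).filter fun t =>
    lo ≤ (F.take t).flatten.length + 1 ∧ (F.take (t + 1)).flatten.length ≤ hi).card

/-- Every word of the list is nonempty, and is a single letter or a factor of `pre` followed by
the words listed before it. -/
def IsFactorSeq {α : Type*} (pre : List α) : List (List α) → Prop
  | [] => True
  | f :: F => f ≠ [] ∧ (f.length = 1 ∨ f <:+: pre) ∧ IsFactorSeq (pre ++ f) F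

theorem isFactorSeq_iff {α : Type*} (F : List (List α)) (pre : List α) :
    IsFactorSeq pre F ↔ ∀ (t : ℕ) (ht : t < F.length), F.get ⟨t, ht⟩ ≠ [] ∧
      ((F.get ⟨t, ht⟩).length = 1 ∨ F.get ⟨t, ht⟩ <:+: pre ++ (F.take t).flatten) := by
  induction F generalizing pre with
  | nil => simp [IsFactorSeq]
  | cons f F ih =>
    simp only [IsFactorSeq, ih]
    constructor
    · rintro ⟨h1, h2, h3⟩ t ht
      cases t with
      | zero => simpa using ⟨h1, h2⟩
      | succ t => simpa using h3 t (by simpa using ht)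
    · intro h
      have h0 := h 0 (by simp)
      refine ⟨by simpa using h0.1, by simpa using h0.2, fun t ht => ?_⟩
      simpa using h (t + 1) (by simpa using ht)

theorem isFactorization_iff {α : Type*} (w : List α) (F : List (List α)) :
    IsFactorization w F ↔ F.flatten = w ∧ IsFactorSeq [] F := by
  rw [isFactorSeq_iff]
  rfl

theorem isFactorSeq_append {α : Type*} (A B : List (List α)) (pre : List α) :
    IsFactorSeq pre (A ++ B) ↔ IsFactorSeq pre A ∧ IsFactorSeq (pre ++ A.flatten) B := by
  induction A generalizing pre with
  | nil => simp [IsFactorSeq]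
  | cons f A ih => simp [IsFactorSeq, ih, and_assoc]

theorem isFactorSeq_of_infix {α : Type*} (v : List α) (G : List (List α))
    (hG : ∀ f ∈ G, f ≠ [] ∧ f <:+: v) (pre : List α) (hv : v <:+: pre) :
    IsFactorSeq pre G := by
  induction G generalizing pre with
  | nil => trivial
  | cons f G ih =>
    have hf := hG f (by simp)
    exact ⟨hf.1, Or.inr (hf.2.trans hv), ih (fun f' hf' => hG f' (by simp [hf'])) _
      (hv.trans (List.prefix_append pre f).isInfix)⟩

theorem slice_infix_of_occurrence {α : Type*} (w v : List α) (p a b : ℕ)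
    (hp : (w.drop p).take v.length = v) (hpa : p ≤ a) (hb : b ≤ p + v.length) :
    (w.drop a).take (b - a) <:+: v := by
  have h : (w.drop a).take (b - a) = (v.drop (a - p)).take (b - a) := by
    conv_rhs => rw [← hp]
    rw [List.drop_take, List.take_take, List.drop_drop]
    congr 1
    · omega
    · congr 1; omega
  rw [h]
  exact (List.take_prefix _ _).isInfix.trans (List.drop_suffix _ _).isInfix

theorem slice_append {α : Type*} (w : List α) (a b c : ℕ) (hab : a ≤ b) (hbc : b ≤ c) :
    (w.drop a).take (b - a) ++ (w.drop b).take (c - b) = (w.drop a).take (c - a) := by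
  have h : c - a = (b - a) + (c - b) := by omega
  rw [h, List.take_add, List.drop_drop]
  congr 4
  omega

/-- If occurrences of `v` cover the positions from `s` to `e`, then this block is a concatenation
of at most `2 * k` nonempty factors of `v` as soon as its length is at most `k * |v|`. -/
theorem exists_factors_of_covered {α : Type*} (w v : List α) (e : ℕ) (he : e ≤ w.length)
    (k s : ℕ) (hse : s ≤ e) (hk : e ≤ s + k * v.length)
    (hcov : ∀ q, s ≤ q → q < e →
      ∃ p, (w.drop p).take v.length = v ∧ p ≤ q ∧ q < p + v.length) :
    ∃ G : List (List α), G.flatten = (w.drop s).take (e - s) ∧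
      (∀ f ∈ G, f ≠ [] ∧ f <:+: v) ∧ G.length ≤ 2 * k := by
  induction k generalizing s with
  | zero =>
    have : e - s = 0 := by omega
    exact ⟨[], by simp [this], by simp, by simp⟩
  | succ k ih =>
    have hne : ∀ a b, a < b → b ≤ e → (w.drop a).take (b - a) ≠ [] := by
      intro a b hab hb h
      have := congrArg List.length h
      simp at this
      omega
    rcases hse.eq_or_lt with rfl | hse
    · exact ⟨[], by simp, by simp, by simp⟩
    classical
    obtain ⟨p₀, hp₀, hp₀s, hsp₀⟩ := hcov s le_rfl hse
    let P : ℕ → Prop := fun p => (w.drop p).take v.length = v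
    set p := Nat.findGreatest P s
    have hpP : P p := Nat.findGreatest_spec (P := P) hp₀s hp₀
    have hps : p ≤ s := Nat.findGreatest_le s
    have hp₀p : p₀ ≤ p := Nat.le_findGreatest (P := P) hp₀s hp₀
    have hmax : ∀ p', P p' → p < p' → s < p' := by
      intro p' hp' hlt
      by_contra hcon
      have := Nat.le_findGreatest (P := P) (not_lt.mp hcon) hp'
      omega
    by_cases h1 : e ≤ p + v.length
    · refine ⟨[(w.drop s).take (e - s)], by simp, ?_, by simp; omega⟩
      simp only [List.mem_singleton, forall_eq]
      exact ⟨hne s e hse le_rfl, slice_infix_of_occurrence w v p s e hpP hps h1⟩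
    push Not at h1
    obtain ⟨p', hp', hp'le, hltp'⟩ := hcov (p + v.length) (by omega) h1
    have hsp' := hmax p' hp' (by omega)
    have hfst : (w.drop s).take (p + v.length - s) ≠ [] ∧
        (w.drop s).take (p + v.length - s) <:+: v :=
      ⟨hne _ _ (by omega) h1.le, slice_infix_of_occurrence w v p s _ hpP hps le_rfl⟩
    obtain ⟨c, hc, hce, hcp', hcase⟩ : ∃ c, p + v.length < c ∧ c ≤ e ∧ c ≤ p' + v.length ∧
        (c = e ∨ c = p' + v.length) := by
      by_cases h2 : e ≤ p' + v.length
      · exact ⟨e, h1, le_rfl, h2, Or.inl rfl⟩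
      · exact ⟨p' + v.length, hltp', by omega, le_rfl, Or.inr rfl⟩
    obtain ⟨G, hGf, hGv, hGl⟩ := ih c hce
      (by rw [Nat.succ_mul] at hk; omega) (fun q hq => hcov q (by omega))
    refine ⟨(w.drop s).take (p + v.length - s) ::
      (w.drop (p + v.length)).take (c - (p + v.length)) :: G, ?_, ?_, ?_⟩
    · rw [List.flatten_cons, List.flatten_cons, hGf, slice_append w _ _ _ hc.le hce,
        slice_append w _ _ _ (by omega) (by omega)]
    · intro f hf
      simp only [List.mem_cons] at hf
      rcases hf with rfl | rfl | hf
      · exact hfst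
      · exact ⟨hne _ _ hc hce, slice_infix_of_occurrence w v p' _ _ hp' hp'le hcp'⟩
      · exact hGv f hf
    · simp only [List.length_cons]; omega

/-- A quasiseed of a long word occurs near its beginning, and its occurrences cover all but
fewer than `|v|` positions at either end. Positions are counted from zero. -/
theorem IsQuasiseed.exists_cover {α : Type*} {v w : List α} (h : IsQuasiseed v w)
    (hlen : 2 * v.length ≤ w.length) :
    (∃ p, p < v.length ∧ (w.drop p).take v.length = v) ∧
      ∀ q, v.length ≤ q + 1 → q + v.length ≤ w.length →
        ∃ p, (w.drop p).take v.length = v ∧ p ≤ q ∧ q < p + v.length := by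
  obtain ⟨-, x, y, z, rfl, hx, hz, hy⟩ := h
  simp only [List.length_append] at hlen
  have hocc : ∀ p, OccursAt y v p →
      ((x ++ y ++ z).drop (x.length + (p - 1))).take v.length = v := by
    rintro p ⟨h1, h2, h3⟩
    rw [List.append_assoc, List.drop_append, List.drop_append]
    have e1 : x.drop (x.length + (p - 1)) = [] := List.drop_eq_nil_of_le (by omega)
    have e2 : x.length + (p - 1) - x.length = p - 1 := by omega
    rw [e1, e2, List.nil_append, List.take_append_of_le_length, h3]
    rw [List.length_drop]
    omega
  constructor
  · obtain ⟨p, hp, hp1, -⟩ := hy 1 le_rfl (by omega)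
    exact ⟨_, by omega, hocc p hp⟩
  · intro q hq1 hq2
    simp only [List.length_append] at hq2
    obtain ⟨p, hp, hp1, hp2⟩ := hy (q + 1 - x.length) (by omega) (by omega)
    have := hp.1
    exact ⟨_, hocc p hp, by omega, by omega⟩

theorem exists_block_of_numFactorsIn_pos {α : Type*} (F : List (List α)) (lo hi : ℕ)
    (h : 0 < NumFactorsIn F lo hi) :
    ∃ a b, a ≤ b ∧ b ≤ F.length ∧ NumFactorsIn F lo hi ≤ b - a ∧
      lo ≤ (F.take a).flatten.length + 1 ∧ (F.take b).flatten.length ≤ hi := by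
  unfold NumFactorsIn at h ⊢
  set S := (Finset.range F.length).filter fun t =>
    lo ≤ (F.take t).flatten.length + 1 ∧ (F.take (t + 1)).flatten.length ≤ hi with hS
  have hne : S.Nonempty := Finset.card_pos.mp h
  have hmin := S.min'_mem hne
  have hmax := S.max'_mem hne
  have hle := S.min'_le _ hmax
  have hmem : ∀ t ∈ S, t < F.length ∧ lo ≤ (F.take t).flatten.length + 1 ∧
      (F.take (t + 1)).flatten.length ≤ hi := fun t ht => by
    rwa [hS, Finset.mem_filter, Finset.mem_range] at ht
  have hmin' := hmem _ hmin
  have hmax' := hmem _ hmax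
  refine ⟨S.min' hne, S.max' hne + 1, by omega, by omega, ?_, hmin'.2.1, hmax'.2.2⟩
  calc S.card ≤ (Finset.Ico (S.min' hne) (S.max' hne + 1)).card := by
        refine Finset.card_le_card fun t ht => ?_
        have h1 := S.min'_le t ht
        have h2 := S.le_max' t ht
        rw [Finset.mem_Ico]
        omega
    _ = _ := Nat.card_Ico _ _

/-- In a minimal factorization, a block of consecutive factors cannot be replaced by fewer
factors of a word that already occurs before the block. -/
theorem IsFFactorization.length_block_le {α : Type*} {w : List α} {F : List (List α)}
    (hF : IsFFactorization w F) {a b : ℕ} (hab : a ≤ b) (hb : b ≤ F.length) (v : List α)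
    (hv : v <:+: (F.take a).flatten) (G : List (List α))
    (hG : ∀ f ∈ G, f ≠ [] ∧ f <:+: v)
    (hflat : (F.take a).flatten ++ G.flatten = (F.take b).flatten) :
    b - a ≤ G.length := by
  obtain ⟨hfac, hmin⟩ := hF
  rw [isFactorization_iff] at hfac
  obtain ⟨hw, hseq⟩ := hfac
  have hsplit := hseq
  rw [← List.take_append_drop b F, isFactorSeq_append] at hsplit
  rw [← List.take_append_drop a F, isFactorSeq_append] at hseq
  have hnew : IsFactorization w ((F.take a ++ G) ++ F.drop b) := by
    rw [isFactorization_iff, isFactorSeq_append, isFactorSeq_append, List.flatten_append,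
      List.flatten_append, hflat]
    refine ⟨?_, ⟨hseq.1, isFactorSeq_of_infix v G hG _ (by simpa using hv)⟩, hsplit.2⟩
    rw [← List.flatten_append, List.take_append_drop, hw]
  have := hmin _ hnew
  simp only [List.length_append, List.length_take, List.length_drop] at this
  omega

theorem work_skipping {α : Type*} (w : List α) (hn : 200 < w.length)
    (F : List (List α)) (hF : IsFFactorization w F) (g : ℕ)
    (hg : g = NumFactorsIn F (2 * (w.length / 50) + 1) (w.length - w.length / 50)) :
    ¬ ∃ v : List α, IsQuasiseed v w ∧ 2 * w.length < g * v.length ∧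
        50 * v.length ≤ w.length := by
  rintro ⟨v, hv, hgv, hvn⟩
  have hgpos : 0 < g := Nat.pos_of_ne_zero (by rintro rfl; simp at hgv)
  have hvpos : 0 < v.length := Nat.pos_of_ne_zero (by intro h; simp [h] at hgv)
  obtain ⟨a, b, hab, hb, hgab, hlo, hhi⟩ := exists_block_of_numFactorsIn_pos F _ _ (hg ▸ hgpos)
  rw [← hg] at hgab
  obtain ⟨⟨p, hpv, hp⟩, hcov⟩ := hv.exists_cover (by omega)
  have htake : ∀ t, (F.take t).flatten = w.take (F.take t).flatten.length := by
    intro t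
    conv_rhs => rw [← hF.1.1, ← List.take_append_drop t F, List.flatten_append]
    simp
  set s := (F.take a).flatten.length
  set e := (F.take b).flatten.length
  have hse : s ≤ e := by
    have : F.take a <+: F.take b := List.take_prefix_take_left hab
    obtain ⟨C, hC⟩ := this
    simp only [s, e, ← hC, List.flatten_append, List.length_append]
    omega
  have hvpre : v <:+: (F.take a).flatten := by
    rw [htake a, ← hp]
    refine ⟨w.take p, (w.drop (p + v.length)).take (s - (p + v.length)), ?_⟩
    have h1 := slice_append w 0 p (p + v.length) (by omega) (by omega)
    have h2 := slice_append w 0 (p + v.length) s (by omega) (by omega)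
    simp only [List.drop_zero, Nat.sub_zero, Nat.add_sub_cancel_left] at h1 h2
    rw [h1, h2]
  obtain ⟨G, hGf, hGv, hGl⟩ := exists_factors_of_covered w v e (by omega)
    ((e - s) / v.length + 1) s hse
    (by
      have := Nat.lt_div_mul_add hvpos (a := e - s)
      rw [Nat.succ_mul]
      omega)
    (fun q hq1 hq2 => hcov q (by omega) (by omega))
  have hle := hF.length_block_le hab hb v hvpre G hGv (by
    rw [hGf, htake a, htake b]
    have := slice_append w 0 s e (by omega) hse
    simpa only [List.drop_zero, Nat.sub_zero] using this)
  have hgk : g ≤ 2 * ((e - s) / v.length + 1) := by omega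
  have hdiv := Nat.div_mul_le_self (e - s) v.length
  have hmul := Nat.mul_le_mul_right v.length hgk
  have : 2 * ((e - s) / v.length + 1) * v.length
      = 2 * ((e - s) / v.length * v.length) + 2 * v.length := by ring
  omega
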